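/- Let X be a compact Hausdorff totally disconnected topological space (a profinite space). Then every point of X is weakly visible: for each x ∈ X there exist subsets U and V of X, each a union of closed subsets with quasi-compact complement (i.e. Thomason subsets), such that {x} = U ∩ Vᶜ. In particular every profinite space is weakly Noetherian. -/

import Mathlib

/-- A subset of a topological space is *Thomason* if it is a union of closed subsets,
each of which has quasi-compact complement. -/
def IsThomason {X : Type*} [TopologicalSpace X] (S : Set X) : Prop :=
  ∃ 𝒮 : Set (Set X), (∀ Z ∈ 𝒮, IsClosed Z ∧ IsCompact Zᶜ) ∧ S = ⋃₀ 𝒮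

/-- A subset `W` is *weakly visible* if `W = U ∩ Vᶜ` for some Thomason subsets `U` and `V`. -/
def IsWeaklyVisible {X : Type*} [TopologicalSpace X] (W : Set X) : Prop :=
  ∃ U V : Set X, IsThomason U ∧ IsThomason V ∧ W = U ∩ Vᶜ

/-- In a compact space, every union of clopen sets is Thomason. -/
theorem isThomason_sUnion_of_isClopen {X : Type*} [TopologicalSpace X] [CompactSpace X]
    {𝒮 : Set (Set X)} (h : ∀ Z ∈ 𝒮, IsClopen Z) : IsThomason (⋃₀ 𝒮) :=
  ⟨𝒮, fun Z hZ => ⟨(h Z hZ).isClosed, (h Z hZ).compl.isClosed.isCompact⟩, rfl⟩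

/-- In a profinite space, every open set is Thomason. -/
theorem IsOpen.isThomason {X : Type*} [TopologicalSpace X] [CompactSpace X] [T2Space X]
    [TotallyDisconnectedSpace X] {S : Set X} (hS : IsOpen S) : IsThomason S := by
  obtain ⟨𝒮, h𝒮, rfl⟩ := (isTopologicalBasis_isClopen (X := X)).open_eq_sUnion hS
  exact isThomason_sUnion_of_isClopen fun Z hZ => h𝒮 hZ

/-- Every point of a profinite space (compact, Hausdorff, totally disconnected) is weakly
visible; in particular every profinite space is weakly Noetherian. -/
theorem stmt4 {X : Type*} [TopologicalSpace X] [CompactSpace X] [T2Space X]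
    [TotallyDisconnectedSpace X] (x : X) :
    IsWeaklyVisible ({x} : Set X) := by
  exact ⟨Set.univ, {x}ᶜ, isOpen_univ.isThomason, isOpen_compl_singleton.isThomason, by simp⟩
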